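/- Let Λ be a finitely aligned k-graph, let 𝓔 ⊆ FE(Λ) be satiated, let v be a vertex of Λ, and let F ∈ vFE(Λ) \ 𝓔. Then there exists an 𝓔-compatible boundary path x with r(x) = v which has no initial segment in F, i.e. x ∈ v∂(Λ;𝓔) \ F∂(Λ;𝓔). -/

import Mathlib

open scoped ENNReal

attribute [local instance] Classical.propDecidable

/-- Product of `f` over a set `S`, in some arbitrary order (junk value `1` if `S` is
infinite).  Used for products of commuting projections. -/
noncomputable def listProd {ι A : Type*} [Monoid A] (S : Set ι) (f : ι → A) : A :=
  if h : S.Finite then (h.toFinset.toList.map f).prod else 1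

/-- A `k`-graph: a countable category `Λ` (whose morphisms are the terms of `Path`, with
vertices identified with the morphisms of degree `0`) together with a degree functor
`d : Λ → ℕ^k` satisfying the factorisation property. -/
structure KGraph (k : ℕ) where
  Path : Type
  countable : Countable Path
  d : Path → Fin k → ℕ
  r : Path → Path
  s : Path → Path
  comp : Path → Path → Path
  d_r : ∀ lam, d (r lam) = 0
  d_s : ∀ lam, d (s lam) = 0
  r_r : ∀ lam, r (r lam) = r lam
  s_r : ∀ lam, s (r lam) = r lam
  r_s : ∀ lam, r (s lam) = s lam
  s_s : ∀ lam, s (s lam) = s lam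
  comp_source : ∀ lam, comp lam (s lam) = lam
  range_comp : ∀ lam, comp (r lam) lam = lam
  r_comp : ∀ lam mu, s lam = r mu → r (comp lam mu) = r lam
  s_comp : ∀ lam mu, s lam = r mu → s (comp lam mu) = s mu
  d_comp : ∀ lam mu, s lam = r mu → d (comp lam mu) = d lam + d mu
  comp_assoc : ∀ lam mu nu, s lam = r mu → s mu = r nu →
    comp (comp lam mu) nu = comp lam (comp mu nu)
  factor : ∀ lam m n, d lam = m + n →
    ∃! p : Path × Path, s p.1 = r p.2 ∧ d p.1 = m ∧ d p.2 = n ∧ comp p.1 p.2 = lam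

namespace KGraph

variable {k : ℕ} (Λ : KGraph k)

/-- Vertices are identified with the paths of degree `0`. -/
def IsVertex (v : Λ.Path) : Prop := Λ.d v = 0

/-- The unique factorisation of `lam` as a product of a path of degree `m` and the
remaining tail (junk value if `¬ m ≤ d lam`). -/
noncomputable def split (lam : Λ.Path) (m : Fin k → ℕ) : Λ.Path × Λ.Path :=
  if h : m ≤ Λ.d lam then
    (Λ.factor lam m (Λ.d lam - m) (by
      funext i
      exact (Nat.add_sub_cancel' (h i)).symm)).choose
  else (lam, lam)

/-- The segment `λ(m,n)` of the path `λ`: the unique path of degree `n - m` such that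
`λ = λ(0,m) λ(m,n) λ(n, d λ)` (meaningful for `m ≤ n ≤ d λ`). -/
noncomputable def seg (lam : Λ.Path) (m n : Fin k → ℕ) : Λ.Path :=
  (Λ.split (Λ.split lam n).1 m).2

/-- `MCE(μ,ν)`: minimal common extensions of `μ` and `ν`. -/
def MCE (mu nu : Λ.Path) : Set Λ.Path :=
  {lam | Λ.d lam = Λ.d mu ⊔ Λ.d nu ∧ Λ.seg lam 0 (Λ.d mu) = mu ∧ Λ.seg lam 0 (Λ.d nu) = nu}

/-- `Λ^min(μ,ν) = {(α,β) : μα = νβ ∈ MCE(μ,ν)}`. -/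
def Lmin (mu nu : Λ.Path) : Set (Λ.Path × Λ.Path) :=
  {p | Λ.s mu = Λ.r p.1 ∧ Λ.s nu = Λ.r p.2 ∧ Λ.comp mu p.1 = Λ.comp nu p.2 ∧
    Λ.comp mu p.1 ∈ Λ.MCE mu nu}

/-- `Ext(μ;E)`: extensions of `μ` with respect to `E`. -/
def Ext (mu : Λ.Path) (E : Set Λ.Path) : Set Λ.Path :=
  {a | Λ.r a = Λ.s mu ∧ ∃ nu ∈ E, ∃ b, (a, b) ∈ Λ.Lmin mu nu}

/-- `Λ` is finitely aligned if all the sets `MCE(μ,ν)` are finite. -/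
def FinitelyAligned : Prop := ∀ mu nu, (Λ.MCE mu nu).Finite

/-- `E ⊆ vΛ` is exhaustive if `Ext(λ;E) ≠ ∅` for all `λ ∈ vΛ`. -/
def Exhaustive (v : Λ.Path) (E : Set Λ.Path) : Prop :=
  ∀ lam, Λ.r lam = v → (Λ.Ext lam E).Nonempty

/-- `E ∈ vFE(Λ)`: `E ⊆ vΛ \ {v}` is finite and exhaustive (so `r(E) = v`). -/
def FEat (v : Λ.Path) (E : Set Λ.Path) : Prop :=
  Λ.IsVertex v ∧ (∀ lam ∈ E, Λ.r lam = v ∧ lam ≠ v) ∧ E.Finite ∧ Λ.Exhaustive v E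

/-- `FE(Λ)`: the finite exhaustive sets. -/
def FE : Set (Set Λ.Path) := {E | ∃ v, Λ.FEat v E}

/-- `λE = {λμ : μ ∈ E, r(μ) = s(λ)}`. -/
def lamSet (lam : Λ.Path) (E : Set Λ.Path) : Set Λ.Path :=
  {x | ∃ mu ∈ E, Λ.s lam = Λ.r mu ∧ Λ.comp lam mu = x}

/-- `EΛ = {λμ : λ ∈ E, r(μ) = s(λ)}`. -/
def setLam (E : Set Λ.Path) : Set Λ.Path :=
  {x | ∃ lam ∈ E, ∃ mu, Λ.s lam = Λ.r mu ∧ Λ.comp lam mu = x}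

/-- `𝓔 ⊆ FE(Λ)` is satiated if it satisfies (S1)--(S4). -/
def Satiated (𝓔 : Set (Set Λ.Path)) : Prop :=
  𝓔 ⊆ Λ.FE ∧
  (∀ G ∈ 𝓔, ∀ E ∈ Λ.FE, G ⊆ E → E ∈ 𝓔) ∧
  (∀ G ∈ 𝓔, ∀ v, Λ.FEat v G → ∀ mu, Λ.r mu = v → mu ∉ Λ.setLam G → Λ.Ext mu G ∈ 𝓔) ∧
  (∀ G ∈ 𝓔, ∀ n : Λ.Path → Fin k → ℕ, (∀ lam ∈ G, 0 < n lam ∧ n lam ≤ Λ.d lam) →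
    ((fun lam => Λ.seg lam 0 (n lam)) '' G) ∈ 𝓔) ∧
  (∀ G ∈ 𝓔, ∀ G' ⊆ G, ∀ Gl : Λ.Path → Set Λ.Path,
    (∀ lam ∈ G', Gl lam ∈ 𝓔 ∧ Λ.FEat (Λ.s lam) (Gl lam)) →
    ((G \ G') ∪ ⋃ lam ∈ G', Λ.lamSet lam (Gl lam)) ∈ 𝓔)

/-- The satiation `𝓔̄` of `𝓔`: the smallest satiated subset of `FE(Λ)` containing `𝓔`. -/
def satiation (𝓔 : Set (Set Λ.Path)) : Set (Set Λ.Path) :=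
  ⋂₀ {F | 𝓔 ⊆ F ∧ Λ.Satiated F}

/-- `ΠE`: the smallest subset of `Λ` containing `E` which is closed under the operation
`(λ,μ,σ) ↦ λ Ext(μ;{σ})` for `λ,μ,σ ∈ ΠE` with `d(λ) = d(μ)`, `s(λ) = s(μ)`. -/
def PiSet (E : Set Λ.Path) : Set Λ.Path :=
  ⋂₀ {G | E ⊆ G ∧ ∀ lam mu sig, lam ∈ G → mu ∈ G → sig ∈ G →
    Λ.d lam = Λ.d mu → Λ.s lam = Λ.s mu → Λ.lamSet lam (Λ.Ext mu {sig}) ⊆ G}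

/-- `Σ₁(𝓔)`: finite sets `F ⊆ r(E)Λ \ Λ⁰` containing some `E ∈ 𝓔`. -/
def Sig1 (𝓔 : Set (Set Λ.Path)) : Set (Set Λ.Path) :=
  {F | ∃ E ∈ 𝓔, ∃ v, Λ.FEat v E ∧ E ⊆ F ∧ F.Finite ∧
    ∀ lam ∈ F, Λ.r lam = v ∧ ¬ Λ.IsVertex lam}

/-- `Σ₂(𝓔) = {Ext(μ;E) : E ∈ 𝓔, μ ∈ r(E)Λ \ EΛ}`. -/
def Sig2 (𝓔 : Set (Set Λ.Path)) : Set (Set Λ.Path) :=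
  {F | ∃ E ∈ 𝓔, ∃ v, Λ.FEat v E ∧ ∃ mu, Λ.r mu = v ∧ mu ∉ Λ.setLam E ∧ F = Λ.Ext mu E}

/-- `Σ₃(𝓔) = {{λ(0,n_λ) : λ ∈ E} : E ∈ 𝓔, 0 < n_λ ≤ d(λ)}`. -/
def Sig3 (𝓔 : Set (Set Λ.Path)) : Set (Set Λ.Path) :=
  {F | ∃ E ∈ 𝓔, ∃ n : Λ.Path → Fin k → ℕ, (∀ lam ∈ E, 0 < n lam ∧ n lam ≤ Λ.d lam) ∧
    F = (fun lam => Λ.seg lam 0 (n lam)) '' E}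

/-- `Σ₄(𝓔) = {(E \ F) ∪ ⋃_{λ ∈ F} λ F_λ : E ∈ 𝓔, F ⊆ E, F_λ ∈ s(λ)𝓔}`. -/
def Sig4 (𝓔 : Set (Set Λ.Path)) : Set (Set Λ.Path) :=
  {G | ∃ E ∈ 𝓔, ∃ F ⊆ E, ∃ Fl : Λ.Path → Set Λ.Path,
    (∀ lam ∈ F, Fl lam ∈ 𝓔 ∧ Λ.FEat (Λ.s lam) (Fl lam)) ∧
    G = (E \ F) ∪ ⋃ lam ∈ F, Λ.lamSet lam (Fl lam)}

/-- `Σ = Σ₄ ∘ Σ₃ ∘ Σ₂ ∘ Σ₁`. -/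
def SigmaStep (𝓔 : Set (Set Λ.Path)) : Set (Set Λ.Path) :=
  Λ.Sig4 (Λ.Sig3 (Λ.Sig2 (Λ.Sig1 𝓔)))

/-- `Σ^∞(𝓔) = ⋃_{n ≥ 1} Σ^n(𝓔)`. -/
def SigmaInf (𝓔 : Set (Set Λ.Path)) : Set (Set Λ.Path) :=
  ⋃ n : ℕ, (Λ.SigmaStep)^[n + 1] 𝓔

section StarAlgebra

variable {A : Type*} [Ring A] [StarRing A]

/-- The product `∏_{λ ∈ E} (t_v - t_λ t_λ*)` (the factors pairwise commute for any
family satisfying (TCK1)--(TCK3), so the implicit choice of ordering is immaterial). -/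
noncomputable def gapProd (t : Λ.Path → A) (v : Λ.Path) (E : Set Λ.Path) : A :=
  listProd E fun lam => t v - t lam * star (t lam)

/-- Conditions (TCK1)--(TCK3) on a family `{t_λ}`. -/
def TCKFamily (t : Λ.Path → A) : Prop :=
  (∀ v, Λ.IsVertex v → star (t v) = t v ∧ t v * t v = t v) ∧
  (∀ v w, Λ.IsVertex v → Λ.IsVertex w → v ≠ w → t v * t w = 0) ∧
  (∀ lam mu, Λ.s lam = Λ.r mu → t lam * t mu = t (Λ.comp lam mu)) ∧
  (∀ lam mu, star (t lam) * t mu = ∑ᶠ p ∈ Λ.Lmin lam mu, t p.1 * star (t p.2))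

/-- A relative Cuntz-Krieger `(Λ;𝓔)`-family: (TCK1)--(TCK3) together with (CK). -/
def RCKFamily (𝓔 : Set (Set Λ.Path)) (t : Λ.Path → A) : Prop :=
  Λ.TCKFamily t ∧ ∀ E ∈ 𝓔, ∀ v, Λ.FEat v E → Λ.gapProd t v E = 0

/-- `Θ(t)^{ΠE}_{λ,μ} = t_λ (∏_{λν ∈ ΠE, d(ν) > 0} (t_{s(λ)} - t_ν t_ν*)) t_μ*`. -/
noncomputable def Theta (t : Λ.Path → A) (E : Set Λ.Path) (lam mu : Λ.Path) : A :=
  t lam *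
    listProd {nu | Λ.s lam = Λ.r nu ∧ ¬ Λ.IsVertex nu ∧ Λ.comp lam nu ∈ Λ.PiSet E}
      (fun nu => t (Λ.s lam) - t nu * star (t nu)) *
    star (t mu)

end StarAlgebra

end KGraph

/-- A graph morphism `x : Ω_{k,m} → Λ`, encoded by its length `m = d(x) ∈ (ℕ∪{∞})^k`
and its values `x(p,q)` on the morphisms `(p,q)` of `Ω_{k,m}` (with the junk value
`x(0,0)` outside the meaningful domain, so graph morphisms are extensional). -/
structure GMor {k : ℕ} (Λ : KGraph k) where
  len : Fin k → ℕ∞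
  seg : (Fin k → ℕ) → (Fin k → ℕ) → Λ.Path
  d_seg : ∀ p q, p ≤ q → (∀ i, (q i : ℕ∞) ≤ len i) → Λ.d (seg p q) = q - p
  r_seg : ∀ p q, p ≤ q → (∀ i, (q i : ℕ∞) ≤ len i) → Λ.r (seg p q) = seg p p
  s_seg : ∀ p q, p ≤ q → (∀ i, (q i : ℕ∞) ≤ len i) → Λ.s (seg p q) = seg q q
  comp_seg : ∀ p q u, p ≤ q → q ≤ u → (∀ i, (u i : ℕ∞) ≤ len i) →
    Λ.comp (seg p q) (seg q u) = seg p u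
  seg_junk : ∀ p q, ¬ (p ≤ q ∧ ∀ i, (q i : ℕ∞) ≤ len i) → seg p q = seg 0 0

namespace GMor

variable {k : ℕ} {Λ : KGraph k}

/-- The range `r(x) = x(0)` of a graph morphism. -/
def range (x : GMor Λ) : Λ.Path := x.seg 0 0

/-- `y = x|_n^{d(x)}`, the restriction of `x` (defined for `n ≤ d(x)`):
`d(y) = d(x) - n` and `y(p,q) = x(n+p, n+q)`. -/
def IsRestriction (y x : GMor Λ) (n : Fin k → ℕ) : Prop :=
  (∀ i, y.len i = x.len i - (n i : ℕ∞)) ∧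
  ∀ p q, p ≤ q → (∀ i, (q i : ℕ∞) ≤ y.len i) → y.seg p q = x.seg (n + p) (n + q)

/-- `y = λx`, the extension of `x` by `λ ∈ Λ r(x)`: `d(y) = d(λ) + d(x)`,
`y(0, d(λ)) = λ` and `y(d(λ), d(λ)+n) = x(0,n)` for `n ≤ d(x)`. -/
def IsExtension (y : GMor Λ) (lam : Λ.Path) (x : GMor Λ) : Prop :=
  (∀ i, y.len i = (Λ.d lam i : ℕ∞) + x.len i) ∧
  y.seg 0 (Λ.d lam) = lam ∧
  ∀ n : Fin k → ℕ, (∀ i, (n i : ℕ∞) ≤ x.len i) →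
    y.seg (Λ.d lam) (Λ.d lam + n) = x.seg 0 n

/-- `x ∈ FΛ^∞`: `x` has an initial segment belonging to `F`. -/
def HasInit (x : GMor Λ) (F : Set Λ.Path) : Prop :=
  ∃ lam ∈ F, (∀ i, (Λ.d lam i : ℕ∞) ≤ x.len i) ∧ x.seg 0 (Λ.d lam) = lam

/-- `z` restricts to `x` on `Ω_{k, d(x)}`. -/
def Agrees (z x : GMor Λ) : Prop :=
  ∀ p q, p ≤ q → (∀ i, (q i : ℕ∞) ≤ x.len i) → z.seg p q = x.seg p q

/-- `z ∈ MCE(x,y)` for graph morphisms `x, y`. -/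
def IsMCE (z x y : GMor Λ) : Prop :=
  (∀ i, z.len i = max (x.len i) (y.len i)) ∧ z.Agrees x ∧ z.Agrees y

/-- `x` is aperiodic: for distinct `λ, μ ∈ Λ r(x)`, `MCE(λx, μx) = ∅`. -/
def Aperiodic (x : GMor Λ) : Prop :=
  ∀ lam mu : Λ.Path, lam ≠ mu → Λ.s lam = x.range → Λ.s mu = x.range →
    ∀ lx mx : GMor Λ, lx.IsExtension lam x → mx.IsExtension mu x →
      ∀ z : GMor Λ, ¬ z.IsMCE lx mx

end GMor

namespace KGraph

variable {k : ℕ} (Λ : KGraph k)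

/-- `x ∈ ∂(Λ;𝓔)`: an `𝓔`-compatible boundary path. -/
def IsBdry (𝓔 : Set (Set Λ.Path)) (x : GMor Λ) : Prop :=
  ∀ n : Fin k → ℕ, (∀ i, (n i : ℕ∞) ≤ x.len i) →
    ∀ E ∈ 𝓔, Λ.FEat (x.seg n n) E →
      ∃ lam ∈ E, (∀ i, ((n + Λ.d lam) i : ℕ∞) ≤ x.len i) ∧ x.seg n (n + Λ.d lam) = lam

/-- Condition (C): aperiodic `𝓔`-compatible boundary paths out of every vertex, and
avoiding any given `F ∈ vFE(Λ) \ 𝓔`. -/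
def CondC (𝓔 : Set (Set Λ.Path)) : Prop :=
  (∀ v, Λ.IsVertex v → ∃ x : GMor Λ, Λ.IsBdry 𝓔 x ∧ x.range = v ∧ x.Aperiodic) ∧
  (∀ v F, Λ.FEat v F → F ∉ 𝓔 →
    ∃ x : GMor Λ, Λ.IsBdry 𝓔 x ∧ x.range = v ∧ ¬ x.HasInit F ∧ x.Aperiodic)

end KGraph

namespace KGraph

variable {k : ℕ} (Λ : KGraph k)

theorem r_eq_self_of_isVertex {v : Λ.Path} (hv : Λ.IsVertex v) : Λ.r v = v := by
  have hv : Λ.d v = 0 := hv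
  have h := (Λ.factor v 0 0 (by simpa using hv)).unique
    (y₁ := (Λ.r v, v)) (y₂ := (v, Λ.s v))
    ⟨Λ.s_r v, Λ.d_r v, hv, Λ.range_comp v⟩ ⟨(Λ.r_s v).symm, hv, Λ.d_s v, Λ.comp_source v⟩
  exact congrArg Prod.fst h

theorem factorisation_unique {a b a' b' : Λ.Path} (h : Λ.s a = Λ.r b) (h' : Λ.s a' = Λ.r b')
    (hc : Λ.comp a b = Λ.comp a' b') (hd : Λ.d a = Λ.d a') : a = a' ∧ b = b' := by
  have e1 := Λ.d_comp a b h
  have e2 := Λ.d_comp a' b' h'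
  have hb : Λ.d b = Λ.d b' := by
    rw [hc, e2, hd] at e1
    exact (add_left_cancel e1).symm
  have := (Λ.factor (Λ.comp a b) (Λ.d a) (Λ.d b) e1).unique
    (y₁ := (a, b)) (y₂ := (a', b')) ⟨h, rfl, rfl, rfl⟩ ⟨h', hd.symm, hb.symm, hc.symm⟩
  exact Prod.ext_iff.1 this

theorem exists_factorisation (lam : Λ.Path) {m : Fin k → ℕ} (hm : m ≤ Λ.d lam) :
    ∃ a b, Λ.s a = Λ.r b ∧ Λ.d a = m ∧ Λ.d b = Λ.d lam - m ∧ Λ.comp a b = lam := by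
  obtain ⟨p, hp, -⟩ := Λ.factor lam m (Λ.d lam - m) (add_tsub_cancel_of_le hm).symm
  exact ⟨p.1, p.2, hp⟩

theorem split_comp {a b : Λ.Path} (h : Λ.s a = Λ.r b) :
    Λ.split (Λ.comp a b) (Λ.d a) = (a, b) := by
  have hle : Λ.d a ≤ Λ.d (Λ.comp a b) := by
    rw [Λ.d_comp a b h]; exact le_self_add
  unfold split
  rw [dif_pos hle]
  generalize_proofs hp
  obtain ⟨h1, h2, -, h4⟩ := hp.choose_spec.1
  obtain ⟨e1, e2⟩ := Λ.factorisation_unique h1 h h4 h2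
  exact Prod.ext e1 e2

/-- `lam = a sig b` with `a` of degree `p` and `a sig` of degree `q`. -/
def IsSeg (lam : Λ.Path) (p q : Fin k → ℕ) (sig : Λ.Path) : Prop :=
  ∃ a b, Λ.s a = Λ.r sig ∧ Λ.s sig = Λ.r b ∧ Λ.d a = p ∧ p + Λ.d sig = q ∧
    Λ.comp (Λ.comp a sig) b = lam

variable {Λ}

theorem IsSeg.seg_eq {lam sig : Λ.Path} {p q : Fin k → ℕ} (h : Λ.IsSeg lam p q sig) :
    Λ.seg lam p q = sig := by
  obtain ⟨a, b, h1, h2, rfl, rfl, rfl⟩ := h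
  unfold seg
  rw [← Λ.d_comp a sig h1, Λ.split_comp (by rw [Λ.s_comp _ _ h1, h2]), Λ.split_comp h1]

theorem isSeg_seg {lam : Λ.Path} {p q : Fin k → ℕ} (hpq : p ≤ q) (hq : q ≤ Λ.d lam) :
    Λ.IsSeg lam p q (Λ.seg lam p q) := by
  obtain ⟨x, b, h1, h2, -, h4⟩ := Λ.exists_factorisation lam hq
  obtain ⟨a, sig, g1, g2, g3, g4⟩ := Λ.exists_factorisation x (h2.symm ▸ hpq)
  have : Λ.IsSeg lam p q sig := by
    refine ⟨a, b, g1, ?_, g2, ?_, by rw [g4, h4]⟩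
    · rw [← h1, ← g4, Λ.s_comp _ _ g1]
    · rw [g3, h2]; exact add_tsub_cancel_of_le hpq
  rwa [this.seg_eq]

theorem IsSeg.range {lam sig : Λ.Path} {p q : Fin k → ℕ} (h : Λ.IsSeg lam p q sig) :
    Λ.IsSeg lam p p (Λ.r sig) := by
  obtain ⟨a, b, h1, h2, h3, h4, h5⟩ := h
  refine ⟨a, Λ.comp sig b, by rw [Λ.r_r, h1], by rw [Λ.s_r, Λ.r_comp _ _ h2], h3,
    by rw [Λ.d_r, add_zero], ?_⟩
  rw [← h1, Λ.comp_source, ← Λ.comp_assoc _ _ _ h1 h2, h5]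

theorem IsSeg.source {lam sig : Λ.Path} {p q : Fin k → ℕ} (h : Λ.IsSeg lam p q sig) :
    Λ.IsSeg lam q q (Λ.s sig) := by
  obtain ⟨a, b, h1, h2, h3, h4, h5⟩ := h
  refine ⟨Λ.comp a sig, b, by rw [Λ.r_s, Λ.s_comp _ _ h1], by rw [Λ.s_s, h2], ?_,
    by rw [Λ.d_s, add_zero], ?_⟩
  · rw [Λ.d_comp _ _ h1, h3, h4]
  · rw [← Λ.s_comp _ _ h1, Λ.comp_source, h5]

theorem comp_seg_seg {lam : Λ.Path} {p q u : Fin k → ℕ} (hpq : p ≤ q) (hqu : q ≤ u)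
    (hu : u ≤ Λ.d lam) : Λ.comp (Λ.seg lam p q) (Λ.seg lam q u) = Λ.seg lam p u := by
  obtain ⟨a, b, h1, h2, h3, h4, h5⟩ := isSeg_seg (hpq.trans hqu) hu
  obtain ⟨x, y, g1, g2, g3, g4⟩ := Λ.exists_factorisation (Λ.seg lam p u) (m := q - p)
    (by
      intro i
      have := hqu i
      have := congrFun h4 i
      simp only [Pi.sub_apply, Pi.add_apply] at *
      omega)
  have ax : Λ.s a = Λ.r x := by rw [h1, ← g4, Λ.r_comp _ _ g1]
  have yb : Λ.s y = Λ.r b := by rw [← h2, ← g4, Λ.s_comp _ _ g1]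
  have hy : q + Λ.d y = u := by
    rw [g3]
    funext i
    have := hpq i
    have := hqu i
    have := congrFun h4 i
    simp only [Pi.sub_apply, Pi.add_apply] at *
    omega
  have ha : Λ.d (Λ.comp a x) = q := by
    rw [Λ.d_comp _ _ ax, h3, g2]; exact add_tsub_cancel_of_le hpq
  have s1 : Λ.IsSeg lam p q x := by
    refine ⟨a, Λ.comp y b, ax, by rw [Λ.r_comp _ _ yb, g1], h3, ?_, ?_⟩
    · rw [g2]; exact add_tsub_cancel_of_le hpq
    · rw [← Λ.comp_assoc _ _ _ (by rw [Λ.s_comp _ _ ax, g1]) yb, Λ.comp_assoc _ _ _ ax g1,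
        g4, h5]
  have s2 : Λ.IsSeg lam q u y := by
    refine ⟨Λ.comp a x, b, by rw [Λ.s_comp _ _ ax, g1], yb, ha, hy, ?_⟩
    rw [Λ.comp_assoc _ _ _ ax g1, g4, h5]
  rw [s1.seg_eq, s2.seg_eq, g4]

variable (Λ) in
/-- `lam` is an initial segment of `mu`. -/
def IsInitial (lam mu : Λ.Path) : Prop := ∃ b, Λ.s lam = Λ.r b ∧ Λ.comp lam b = mu

theorem IsInitial.refl (lam : Λ.Path) : Λ.IsInitial lam lam :=
  ⟨Λ.s lam, (Λ.r_s lam).symm, Λ.comp_source lam⟩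

theorem IsInitial.trans {lam mu nu : Λ.Path} (h : Λ.IsInitial lam mu)
    (h' : Λ.IsInitial mu nu) : Λ.IsInitial lam nu := by
  obtain ⟨b, h1, rfl⟩ := h
  obtain ⟨c, h2, rfl⟩ := h'
  rw [Λ.s_comp _ _ h1] at h2
  exact ⟨Λ.comp b c, by rw [Λ.r_comp _ _ h2, h1], (Λ.comp_assoc _ _ _ h1 h2).symm⟩

theorem IsInitial.d_le {lam mu : Λ.Path} (h : Λ.IsInitial lam mu) : Λ.d lam ≤ Λ.d mu := by
  obtain ⟨b, h1, rfl⟩ := h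
  rw [Λ.d_comp _ _ h1]; exact le_self_add

theorem IsSeg.of_isInitial {lam mu sig : Λ.Path} {p q : Fin k → ℕ} (h : Λ.IsSeg lam p q sig)
    (hlm : Λ.IsInitial lam mu) : Λ.IsSeg mu p q sig := by
  obtain ⟨a, b, h1, h2, h3, h4, rfl⟩ := h
  obtain ⟨c, hc, rfl⟩ := hlm
  have hab : Λ.s (Λ.comp a sig) = Λ.r b := by rw [Λ.s_comp _ _ h1, h2]
  rw [Λ.s_comp _ _ hab] at hc
  exact ⟨a, Λ.comp b c, h1, by rw [Λ.r_comp _ _ hc, h2], h3, h4,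
    (Λ.comp_assoc _ _ _ hab hc).symm⟩

theorem IsSeg.mem_setLam {lam sig : Λ.Path} {q : Fin k → ℕ} {F : Set Λ.Path}
    (h : Λ.IsSeg lam 0 q sig) (hsig : sig ∈ F) : lam ∈ Λ.setLam F := by
  obtain ⟨a, b, h1, h2, h3, h4, h5⟩ := h
  have ha : a = Λ.r sig := by
    have h6 : Λ.s (Λ.r a) = Λ.r a := Λ.s_r a
    have := Λ.factorisation_unique (a := a) (b := Λ.s a) (a' := Λ.r a) (b' := a)
      (Λ.r_s a).symm h6 (by rw [Λ.comp_source, Λ.range_comp]) (by rw [h3, Λ.d_r])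
    rw [← h1, this.2]
  rw [ha, Λ.range_comp] at h5
  exact ⟨sig, hsig, b, h2, h5⟩

theorem FEat.nonempty {v : Λ.Path} {E : Set Λ.Path} (h : Λ.FEat v E) : E.Nonempty := by
  obtain ⟨_, -, nu, hnu, -⟩ := h.2.2.2 v (Λ.r_eq_self_of_isVertex h.1)
  exact ⟨nu, hnu⟩

theorem feat_of_mem_FE {E : Set Λ.Path} (h : E ∈ Λ.FE) {v : Λ.Path}
    (hr : ∀ lam ∈ E, Λ.r lam = v) : Λ.FEat v E := by
  obtain ⟨w, hw⟩ := h
  obtain ⟨lam, hlam⟩ := hw.nonempty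
  rw [← hr lam hlam, (hw.2.1 lam hlam).1]
  exact hw

variable (Λ) in
/-- A path with range `v` and no initial segment in `F`, such that no member of `𝓔` at its
source consists of paths leading into `FΛ`. -/
def Avoids (𝓔 : Set (Set Λ.Path)) (v : Λ.Path) (F : Set Λ.Path) (lam : Λ.Path) : Prop :=
  Λ.r lam = v ∧ lam ∉ Λ.setLam F ∧
    ∀ E ∈ 𝓔, ¬ ∀ b ∈ E, Λ.s lam = Λ.r b ∧ Λ.comp lam b ∈ Λ.setLam F

theorem FEat.avoids {𝓔 : Set (Set Λ.Path)} (h𝓔 : Λ.Satiated 𝓔) {v : Λ.Path}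
    {F : Set Λ.Path} (hF : Λ.FEat v F) (hFne : F ∉ 𝓔) : Λ.Avoids 𝓔 v F v := by
  have hrv := Λ.r_eq_self_of_isVertex hF.1
  have hpos : ∀ f ∈ F, 0 < Λ.d f := by
    intro f hf
    refine pos_iff_ne_zero.2 fun h0 => (hF.2.1 f hf).2 ?_
    rw [← (hF.2.1 f hf).1, Λ.r_eq_self_of_isVertex h0]
  refine ⟨hrv, ?_, ?_⟩
  · rintro ⟨f, hf, b, h1, h2⟩
    have h3 := Λ.d_comp _ _ h1
    rw [h2, show Λ.d v = 0 from hF.1] at h3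
    exact (hpos f hf).ne' (add_eq_zero.1 h3.symm).1
  · intro E hE hEF
    have key : ∀ b : Λ.Path, ∃ n : Fin k → ℕ, b ∈ E → 0 < n ∧ n ≤ Λ.d b ∧
        Λ.seg b 0 n ∈ F := by
      intro b
      by_cases hb : b ∈ E
      · obtain ⟨h1, h2⟩ := hEF b hb
        have hsv : Λ.s v = v := by rw [← hrv, Λ.s_r]
        have hvb : Λ.comp v b = b := by
          rw [show v = Λ.r b by rw [← h1, hsv], Λ.range_comp]
        rw [hvb] at h2
        obtain ⟨f, hf, c, hfc, rfl⟩ := h2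
        refine ⟨Λ.d f, fun _ => ⟨hpos f hf, by rw [Λ.d_comp _ _ hfc]; exact le_self_add, ?_⟩⟩
        have : Λ.IsSeg (Λ.comp f c) 0 (Λ.d f) f :=
          ⟨Λ.r f, c, Λ.s_r f, hfc, Λ.d_r f, zero_add _, by rw [Λ.range_comp]⟩
        rwa [this.seg_eq]
      · exact ⟨0, fun h => (hb h).elim⟩
    choose n hn using key
    refine hFne (h𝓔.2.1 _ (h𝓔.2.2.2.1 E hE n fun b hb => ⟨(hn b hb).1, (hn b hb).2.1⟩) F
      ⟨v, hF⟩ ?_)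
    rintro _ ⟨b, hb, rfl⟩
    exact (hn b hb).2.2

theorem Avoids.exists_comp {𝓔 : Set (Set Λ.Path)} (h𝓔 : Λ.Satiated 𝓔) {v lam : Λ.Path}
    {F G : Set Λ.Path} (h : Λ.Avoids 𝓔 v F lam) (hG : G ∈ 𝓔)
    (hr : ∀ a ∈ G, Λ.r a = Λ.s lam) : ∃ a ∈ G, Λ.Avoids 𝓔 v F (Λ.comp lam a) := by
  by_contra! hcon
  have key : ∀ a : Λ.Path, ∃ E : Set Λ.Path, a ∈ G → Λ.comp lam a ∉ Λ.setLam F → E ∈ 𝓔 ∧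
      ∀ b ∈ E, Λ.s a = Λ.r b ∧ Λ.comp (Λ.comp lam a) b ∈ Λ.setLam F := by
    intro a
    by_cases ha : a ∈ G ∧ Λ.comp lam a ∉ Λ.setLam F
    · have hla : Λ.s lam = Λ.r a := (hr a ha.1).symm
      have := hcon a ha.1
      obtain ⟨E, hE, hEF⟩ : ∃ E ∈ 𝓔, ∀ b ∈ E, Λ.s (Λ.comp lam a) = Λ.r b ∧
          Λ.comp (Λ.comp lam a) b ∈ Λ.setLam F := by
        by_contra! hE
        exact this ⟨by rw [Λ.r_comp _ _ hla, h.1], ha.2, fun E hE' hall => by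
          obtain ⟨b, hb, hb'⟩ := hE E hE'
          exact hb' (hall b hb).1 (hall b hb).2⟩
      rw [Λ.s_comp _ _ hla] at hEF
      exact ⟨E, fun _ _ => ⟨hE, hEF⟩⟩
    · exact ⟨∅, fun h1 h2 => (ha ⟨h1, h2⟩).elim⟩
  choose Gl hGl using key
  have hH := h𝓔.2.2.2.2 G hG {a ∈ G | Λ.comp lam a ∉ Λ.setLam F} (fun a ha => ha.1) Gl
    (fun a ha => ⟨(hGl a ha.1 ha.2).1, feat_of_mem_FE (h𝓔.1 (hGl a ha.1 ha.2).1)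
      fun b hb => ((hGl a ha.1 ha.2).2 b hb).1.symm⟩)
  refine h.2.2 _ hH ?_
  rintro b (⟨hb, hb'⟩ | hb)
  · refine ⟨(hr b hb).symm, ?_⟩
    by_contra hc
    exact hb' ⟨hb, hc⟩
  · simp only [Set.mem_iUnion] at hb
    obtain ⟨a, ha, c, hc, hac, rfl⟩ := hb
    have hla := hr a ha.1
    refine ⟨by rw [Λ.r_comp _ _ hac, hla], ?_⟩
    rw [← Λ.comp_assoc _ _ _ hla.symm hac]
    exact ((hGl a ha.1 ha.2).2 c hc).2

theorem Avoids.exists_isSeg {𝓔 : Set (Set Λ.Path)} (h𝓔 : Λ.Satiated 𝓔) {v lam : Λ.Path}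
    {F : Set Λ.Path} (h : Λ.Avoids 𝓔 v F lam) (p : Fin k → ℕ) (E : Set Λ.Path) :
    ∃ mu, Λ.Avoids 𝓔 v F mu ∧ Λ.IsInitial lam mu ∧
      (p ≤ Λ.d lam → E ∈ 𝓔 → Λ.FEat (Λ.seg lam p p) E →
        ∃ e ∈ E, Λ.IsSeg mu p (p + Λ.d e) e) := by
  by_cases hc : p ≤ Λ.d lam ∧ E ∈ 𝓔 ∧ Λ.FEat (Λ.seg lam p p) E
  swap
  · exact ⟨lam, h, IsInitial.refl lam, fun h1 h2 h3 => (hc ⟨h1, h2, h3⟩).elim⟩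
  obtain ⟨hp, hE, hEat⟩ := hc
  obtain ⟨a, mu, h1, h2, h3, h4⟩ := Λ.exists_factorisation lam hp
  have hseg : Λ.seg lam p p = Λ.r mu := by
    refine IsSeg.seg_eq ⟨a, mu, by rw [Λ.r_r, h1], Λ.s_r mu, h2, by rw [Λ.d_r, add_zero], ?_⟩
    rw [← h1, Λ.comp_source, h4]
  rw [hseg] at hEat
  by_cases hmu : mu ∈ Λ.setLam E
  · refine ⟨lam, h, IsInitial.refl lam, fun _ _ _ => ?_⟩
    obtain ⟨e, he, t, het, rfl⟩ := hmu
    rw [Λ.r_comp _ _ het] at h1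
    exact ⟨e, he, a, t, h1, het, h2, rfl, by rw [Λ.comp_assoc _ _ _ h1 het, h4]⟩
  · have hs : Λ.s lam = Λ.s mu := by rw [← h4, Λ.s_comp _ _ h1]
    obtain ⟨c, ⟨hcr, e, he, b, g1, g2, g3, -⟩, hav⟩ := h.exists_comp h𝓔
      (h𝓔.2.2.1 E hE _ hEat mu rfl hmu) fun c hc => hc.1.trans hs.symm
    refine ⟨_, hav, ⟨c, by rw [hs, hcr], rfl⟩, fun _ _ _ => ⟨e, he, a, b, ?_, g2, h2, rfl, ?_⟩⟩
    all_goals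
      simp only at g1 g2 g3
      have hae : Λ.s a = Λ.r e := by
        rw [h1, ← Λ.r_comp _ _ g1, g3, Λ.r_comp _ _ g2]
    · exact hae
    · rw [Λ.comp_assoc _ _ _ hae g2, ← g3, ← Λ.comp_assoc _ _ _ h1 g1, h4]

theorem isInitial_of_le {L : ℕ → Λ.Path} (hL : ∀ n, Λ.IsInitial (L n) (L (n + 1))) {m n : ℕ}
    (h : m ≤ n) : Λ.IsInitial (L m) (L n) := by
  induction h with
  | refl => exact IsInitial.refl _
  | step _ ih => exact ih.trans (hL _)

theorem exists_le_d_of_le_iSup {L : ℕ → Λ.Path} (hL : ∀ n, Λ.IsInitial (L n) (L (n + 1)))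
    {q : Fin k → ℕ} (hq : ∀ i, (q i : ℕ∞) ≤ ⨆ n, (Λ.d (L n) i : ℕ∞)) :
    ∃ N, q ≤ Λ.d (L N) := by
  have key : ∀ i, ∃ N, q i ≤ Λ.d (L N) i := by
    intro i
    by_contra! hlt
    have h0 : 0 < q i := (Nat.zero_le _).trans_lt (hlt 0)
    have : (q i : ℕ∞) ≤ ((q i - 1 : ℕ) : ℕ∞) :=
      (hq i).trans (iSup_le fun n => by
        have := hlt n
        exact_mod_cast (by omega : Λ.d (L n) i ≤ q i - 1))
    have : q i ≤ q i - 1 := by exact_mod_cast this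
    omega
  choose N hN using key
  exact ⟨Finset.univ.sup N, fun i => (hN i).trans
    ((isInitial_of_le hL (Finset.le_sup (Finset.mem_univ i))).d_le i)⟩

/-- An increasing sequence of paths has a limiting graph morphism. -/
theorem exists_gMor_of_isInitial {L : ℕ → Λ.Path}
    (hL : ∀ n, Λ.IsInitial (L n) (L (n + 1))) :
    ∃ x : GMor Λ, (∀ i, x.len i = ⨆ n, (Λ.d (L n) i : ℕ∞)) ∧
      ∀ N p q, p ≤ q → q ≤ Λ.d (L N) → x.seg p q = Λ.seg (L N) p q := by
  have indep : ∀ M N p q, p ≤ q → q ≤ Λ.d (L M) → q ≤ Λ.d (L N) →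
      Λ.seg (L M) p q = Λ.seg (L N) p q := by
    intro M N p q hpq hM hN
    rcases le_total M N with h | h
    · exact ((isSeg_seg hpq hM).of_isInitial (isInitial_of_le hL h)).seg_eq.symm
    · exact ((isSeg_seg hpq hN).of_isInitial (isInitial_of_le hL h)).seg_eq
  let f : (Fin k → ℕ) → (Fin k → ℕ) → Λ.Path := fun p q =>
    if h : p ≤ q ∧ ∃ N, q ≤ Λ.d (L N) then Λ.seg (L h.2.choose) p q else Λ.seg (L 0) 0 0
  have hf : ∀ N p q, p ≤ q → q ≤ Λ.d (L N) → f p q = Λ.seg (L N) p q := by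
    intro N p q hpq hN
    have h : p ≤ q ∧ ∃ N, q ≤ Λ.d (L N) := ⟨hpq, N, hN⟩
    simp only [f]
    rw [dif_pos h]
    exact indep _ _ _ _ hpq h.2.choose_spec hN
  refine ⟨⟨fun i => ⨆ n, (Λ.d (L n) i : ℕ∞), f, ?_, ?_, ?_, ?_, ?_⟩, fun i => rfl, hf⟩
  · intro p q hpq hq
    obtain ⟨N, hN⟩ := exists_le_d_of_le_iSup hL hq
    rw [hf N p q hpq hN]
    obtain ⟨-, -, -, -, -, h, -⟩ := isSeg_seg hpq hN
    exact eq_tsub_of_add_eq (by rw [add_comm, h])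
  · intro p q hpq hq
    obtain ⟨N, hN⟩ := exists_le_d_of_le_iSup hL hq
    rw [hf N p q hpq hN, hf N p p le_rfl (hpq.trans hN), (isSeg_seg hpq hN).range.seg_eq]
  · intro p q hpq hq
    obtain ⟨N, hN⟩ := exists_le_d_of_le_iSup hL hq
    rw [hf N p q hpq hN, hf N q q le_rfl hN, (isSeg_seg hpq hN).source.seg_eq]
  · intro p q u hpq hqu hu
    obtain ⟨N, hN⟩ := exists_le_d_of_le_iSup hL hu
    rw [hf N p q hpq (hqu.trans hN), hf N q u hqu hN, hf N p u (hpq.trans hqu) hN,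
      comp_seg_seg hpq hqu hN]
  · intro p q hpq
    rw [hf 0 0 0 le_rfl zero_le]
    refine dif_neg ?_
    rintro ⟨h1, N, hN⟩
    exact hpq ⟨h1, fun i => (Nat.cast_le.2 (hN i)).trans
      (le_iSup (fun n => (Λ.d (L n) i : ℕ∞)) N)⟩

/-- Every member of `𝓔` is eventually met along a suitable increasing sequence of paths
avoiding `F`. -/
theorem exists_avoiding_sequence {𝓔 : Set (Set Λ.Path)} (h𝓔 : Λ.Satiated 𝓔) {v : Λ.Path}
    {F : Set Λ.Path} (hF : Λ.FEat v F) (hFne : F ∉ 𝓔) :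
    ∃ L : ℕ → Λ.Path, (∀ n, Λ.IsInitial (L n) (L (n + 1))) ∧ (∀ n, Λ.Avoids 𝓔 v F (L n)) ∧
      ∀ N p, p ≤ Λ.d (L N) → ∀ E ∈ 𝓔, Λ.FEat (Λ.seg (L N) p p) E →
        ∃ M, ∃ e ∈ E, Λ.IsSeg (L M) p (p + Λ.d e) e := by
  have := Λ.countable
  obtain ⟨g, hg⟩ := exists_surjective_nat ((Fin k → ℕ) × Finset Λ.Path)
  choose step h1 h2 h3 using fun (lam : {lam // Λ.Avoids 𝓔 v F lam})
    (t : (Fin k → ℕ) × Finset Λ.Path) => lam.2.exists_isSeg h𝓔 t.1 (t.2 : Set Λ.Path)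
  let L : ℕ → {lam // Λ.Avoids 𝓔 v F lam} := fun n =>
    Nat.rec ⟨v, hF.avoids h𝓔 hFne⟩ (fun n lam => ⟨step lam (g n.unpair.2), h1 _ _⟩) n
  have hL : ∀ n, Λ.IsInitial (L n).1 (L (n + 1)).1 := fun n => h2 (L n) (g n.unpair.2)
  refine ⟨fun n => (L n).1, hL, fun n => (L n).2, ?_⟩
  intro N p hp E hE hEat
  obtain ⟨m, hm⟩ := hg (p, hEat.2.2.1.toFinset)
  have hi := isInitial_of_le (L := fun n => (L n).1) hL (Nat.left_le_pair N m)
  have := h3 (L (Nat.pair N m)) (g (Nat.pair N m).unpair.2)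
  rw [Nat.unpair_pair, hm] at this
  simp only [Set.Finite.coe_toFinset] at this
  obtain ⟨e, he, hseg⟩ := this (hp.trans hi.d_le) hE
    (by rwa [((isSeg_seg le_rfl hp).of_isInitial hi).seg_eq])
  refine ⟨Nat.pair N m + 1, e, he, ?_⟩
  have hstep : (L (Nat.pair N m + 1)).1 = step (L (Nat.pair N m)) (p, hEat.2.2.1.toFinset) := by
    change step (L (Nat.pair N m)) (g (Nat.pair N m).unpair.2) = _
    rw [Nat.unpair_pair, hm]
  simp only [hstep]
  exact hseg

end KGraph

/-- Lemma 4.8(2): if `F ∈ vFE(Λ) \ 𝓔` then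
`v ∂(Λ;𝓔) \ F ∂(Λ;𝓔)` is nonempty. -/
theorem statement5 {k : ℕ} (Λ : KGraph k) (hΛ : Λ.FinitelyAligned)
    (𝓔 : Set (Set Λ.Path)) (h𝓔 : Λ.Satiated 𝓔)
    (v : Λ.Path) (F : Set Λ.Path) (hF : Λ.FEat v F) (hFne : F ∉ 𝓔) :
    ∃ x : GMor Λ, Λ.IsBdry 𝓔 x ∧ x.range = v ∧ ¬ x.HasInit F := by
  obtain ⟨L, hL, hav, htask⟩ := KGraph.exists_avoiding_sequence h𝓔 hF hFne
  obtain ⟨x, hlen, hseg⟩ := KGraph.exists_gMor_of_isInitial hL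
  refine ⟨x, ?_, ?_, ?_⟩
  · intro n hn E hE hEat
    simp only [hlen] at hn
    obtain ⟨N, hN⟩ := KGraph.exists_le_d_of_le_iSup hL hn
    rw [hseg N n n le_rfl hN] at hEat
    obtain ⟨M, e, he, hs⟩ := htask N n hN E hE hEat
    have hle : n + Λ.d e ≤ Λ.d (L M) := by
      obtain ⟨a, b, h1, h2, h3, -, h5⟩ := hs
      rw [← h5, Λ.d_comp _ _ (by rw [Λ.s_comp _ _ h1, h2]), Λ.d_comp _ _ h1, h3]
      exact le_self_add
    refine ⟨e, he, fun i => ?_, ?_⟩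
    · rw [hlen]
      exact (Nat.cast_le.2 (hle i)).trans (le_iSup (fun n => (Λ.d (L n) i : ℕ∞)) M)
    · rw [hseg M _ _ le_self_add hle, hs.seg_eq]
  · rw [GMor.range, hseg 0 0 0 le_rfl zero_le, ← (hav 0).1]
    refine KGraph.IsSeg.seg_eq ⟨Λ.r (L 0), L 0, ?_, Λ.s_r _, Λ.d_r _, ?_, ?_⟩
    · rw [Λ.s_r, Λ.r_r]
    · rw [Λ.d_r, add_zero]
    · rw [show Λ.comp (Λ.r (L 0)) (Λ.r (L 0)) = Λ.r (L 0) by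
        simpa only [Λ.r_r] using Λ.range_comp (Λ.r (L 0))]
      exact Λ.range_comp _
  · rintro ⟨f, hf, hd, hxf⟩
    simp only [hlen] at hd
    obtain ⟨N, hN⟩ := KGraph.exists_le_d_of_le_iSup hL hd
    have hs := KGraph.isSeg_seg zero_le hN
    rw [← hseg N _ _ zero_le hN, hxf] at hs
    exact (hav N).2.1 (hs.mem_setLam hf)
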